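/- Composition of flows (Lemma 2.7): let A be a differential graded Lie algebra over a field k of characteristic zero, and let e_1, e_2 ∈ A_0 be such that the Lie subalgebra L of A_0 generated by e_1 and e_2 acts nilpotently on A, in the sense that there is an N such that every composition of N operators ad_x with x ∈ L vanishes. Then there exists z ∈ L (namely the Baker–Campbell–Hausdorff composition BCH(e_1, e_2)) such that exp(−ad_z) = exp(−ad_{e_2}) ∘ exp(−ad_{e_1}) as operators on A and u_{e_2}(u_{e_1}(a)) = u_z(a) for every a ∈ A_{−1}. -/

import Mathlib

/-- A differential graded Lie algebra (DGLA) over a field `k` of characteristic zero: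
a `ℤ`-graded `k`-vector space `A = ⊕ₙ Aₙ` with a bilinear bracket respecting the grading,
graded antisymmetry, the graded Jacobi identity, and a differential `∂` of degree `-1`
with `∂ ∘ ∂ = 0` satisfying the graded Leibniz rule. -/
class DGLA (k : Type*) (A : Type*) [Field k] [CharZero k]
    [AddCommGroup A] [Module k A] where
  bracket : A →ₗ[k] A →ₗ[k] A
  grading : ℤ → Submodule k A
  isInternal : DirectSum.IsInternal grading
  bracket_mem : ∀ (m n : ℤ) (a b : A), a ∈ grading m → b ∈ grading n →
    bracket a b ∈ grading (m + n)
  bracket_antisymm : ∀ (m n : ℤ) (a b : A), a ∈ grading m → b ∈ grading n →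
    bracket b a = -(((-1 : k) ^ (m * n)) • bracket a b)
  jacobi : ∀ (l m n : ℤ) (a b c : A), a ∈ grading l → b ∈ grading m → c ∈ grading n →
    ((-1 : k) ^ (l * m)) • bracket (bracket b c) a
      + ((-1 : k) ^ (m * n)) • bracket (bracket c a) b
      + ((-1 : k) ^ (n * l)) • bracket (bracket a b) c = 0
  d : A →ₗ[k] A
  d_mem : ∀ (n : ℤ) (a : A), a ∈ grading n → d a ∈ grading (n - 1)
  d_sq : ∀ a : A, d (d a) = 0
  leibniz : ∀ (m : ℤ) (a b : A), a ∈ grading m →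
    d (bracket a b) = bracket (d a) b + ((-1 : k) ^ m) • bracket a (d b)

namespace DGLA

variable (k : Type*) {A : Type*} [Field k] [CharZero k] [AddCommGroup A] [Module k A]
  [DGLA k A]

/-- The differential `∂` of the DGLA. -/
noncomputable def D : A →ₗ[k] A := DGLA.d (k := k) (A := A)

/-- The bracket `[x, y]` of the DGLA. -/
noncomputable def br (x y : A) : A := DGLA.bracket (k := k) (A := A) x y

/-- The `n`-th graded piece `Aₙ`. -/
noncomputable def gr (n : ℤ) : Submodule k A := DGLA.grading (k := k) (A := A) n

/-- The adjoint operator `ad_x = [x, ·]`. -/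
noncomputable def ad (x : A) : Module.End k A := DGLA.bracket (k := k) (A := A) x

/-- A *point*: an element of `A₋₁` satisfying the Maurer–Cartan equation
`∂a + (1/2)[a,a] = 0`. -/
def IsPoint (a : A) : Prop :=
  a ∈ gr k (-1) ∧ D k a + (2⁻¹ : k) • br k a a = 0

/-- The twisted differential `∂_a = ∂ + ad_a`. -/
noncomputable def twistD (a : A) : Module.End k A := D k + ad k a

/-- The curvature `κ(a) = ∂a + (1/2)[a,a]`. -/
noncomputable def curv (a : A) : A := D k a + (2⁻¹ : k) • br k a a

/-- The truncated operator power series `Σ_{n<N} (−1)ⁿ fⁿ/n!`; when `f^N = 0` this is the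
exponential `exp(−f)` (a finite sum by nilpotency). -/
noncomputable def expNeg (f : Module.End k A) (N : ℕ) : Module.End k A :=
  ∑ n ∈ Finset.range N, ((-1 : k) ^ n * (Nat.factorial n : k)⁻¹) • f ^ n

/-- The truncated operator power series `F(f) = Σ_{n<N} (−1)ⁿ fⁿ/(n+1)!`; when `f^N = 0`
this is the power series of `(1 − e^{−T})/T` evaluated at `f` (a finite sum by nilpotency). -/
noncomputable def Fser (f : Module.End k A) (N : ℕ) : Module.End k A :=
  ∑ n ∈ Finset.range N, ((-1 : k) ^ n * (Nat.factorial (n + 1) : k)⁻¹) • f ^ n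

/-- The time-one flow `u_e(a) := exp(−ad_e)(a) + F(ad_e)(∂e)` of `e ∈ A₀` applied to
`a ∈ A₋₁`, truncated at order `N` (exact when `(ad_e)^N = 0`). -/
noncomputable def flow (e : A) (N : ℕ) (a : A) : A :=
  expNeg k (ad k e) N a + Fser k (ad k e) N (D k e)

end DGLA

namespace BCHaux

open Finset (range sum_congr)
open Finset.HasAntidiagonal (antidiagonal)
open IsNilpotent

theorem sum_diag {S : Type*} [AddCommMonoid S] (f : ℕ → ℕ → S) (B : ℕ)
    (h : ∀ i j, B ≤ i + j → f i j = 0) :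
    ∑ n ∈ range B, ∑ p ∈ antidiagonal n, f p.1 p.2 = ∑ i ∈ range B, ∑ j ∈ range B, f i j := by
  have h1 : ∀ n ∈ range B, ∑ p ∈ antidiagonal n, f p.1 p.2
      = ∑ i ∈ range (n + 1), f i (n - i) := fun n _ =>
    Finset.Nat.sum_antidiagonal_eq_sum_range_succ f n
  rw [Finset.sum_congr rfl h1, Finset.sum_range_diag_flip]
  refine Finset.sum_congr rfl fun i hi => ?_
  refine Finset.sum_subset ?_ ?_
  · intro j hj
    simp only [Finset.mem_range] at *
    omega
  · intro j hj hj'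
    simp only [Finset.mem_range] at *
    exact h _ _ (by omega)

section deriv
variable {S : Type*} [Ring S] [Algebra ℚ S]

theorem deriv_pow (D : S →ₗ[ℚ] S) (hD : ∀ a b, D (a * b) = D a * b + a * D b) (Z : S)
    (a : ℕ → S) (ha0 : a 0 = D Z) (ha : ∀ n, a (n + 1) = Z * a n - a n * Z) (n : ℕ) :
    D (Z ^ (n + 1)) = ∑ p ∈ antidiagonal n, ((n + 1).choose (p.1 + 1) : ℚ) • (a p.1 * Z ^ p.2) := by
  induction n with
  | zero => simp [ha0]
  | succ n ih =>
    rw [pow_succ' Z (n + 1), hD, ih]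
    have e1 : ∑ p ∈ antidiagonal (n + 1), ((n + 1 + 1).choose (p.1 + 1) : ℚ) • (a p.1 * Z ^ p.2)
        = ∑ p ∈ antidiagonal (n + 1), ((n + 1).choose p.1 : ℚ) • (a p.1 * Z ^ p.2)
        + ∑ p ∈ antidiagonal (n + 1), ((n + 1).choose (p.1 + 1) : ℚ) • (a p.1 * Z ^ p.2) := by
      rw [← Finset.sum_add_distrib]
      refine Finset.sum_congr rfl fun p _ => ?_
      rw [Nat.choose_succ_succ, ← add_smul]
      push_cast
      rfl
    rw [e1, Finset.Nat.sum_antidiagonal_succ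
      (f := fun p : ℕ × ℕ => ((n + 1).choose p.1 : ℚ) • (a p.1 * Z ^ p.2)),
      Finset.Nat.sum_antidiagonal_succ'
      (f := fun p : ℕ × ℕ => ((n + 1).choose (p.1 + 1) : ℚ) • (a p.1 * Z ^ p.2))]
    simp only [Nat.choose_zero_right, Nat.cast_one, one_smul, ha0,
      Nat.choose_succ_self, Nat.cast_zero, zero_smul, zero_add]
    rw [add_assoc, ← Finset.sum_add_distrib, Finset.mul_sum]
    congr 1
    refine Finset.sum_congr rfl fun p _ => ?_
    rw [← smul_add, mul_smul_comm, ha, pow_succ' Z p.2]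
    congr 1
    noncomm_ring

theorem deriv_exp (D : S →ₗ[ℚ] S) (hD : ∀ a b, D (a * b) = D a * b + a * D b) (Z : S)
    (hZ : IsNilpotent Z)
    (a : ℕ → S) (ha0 : a 0 = D Z) (ha : ∀ n, a (n + 1) = Z * a n - a n * Z) :
    ∃ B : ℕ, D (exp Z) = (∑ k ∈ range (B + 1), ((k + 1).factorial : ℚ)⁻¹ • a k) * exp Z := by
  have hadn : IsNilpotent (LinearMap.mulLeft ℚ Z - LinearMap.mulRight ℚ Z) := by
    have hl : IsNilpotent (LinearMap.mulLeft ℚ Z) := by rwa [LinearMap.isNilpotent_mulLeft_iff]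
    have hr : IsNilpotent (LinearMap.mulRight ℚ Z) := by rwa [LinearMap.isNilpotent_mulRight_iff]
    exact (LinearMap.commute_mulLeft_right Z Z).isNilpotent_sub hl hr
  obtain ⟨K₂, hK₂⟩ := hadn
  obtain ⟨K, hK⟩ := hZ
  have haeq : ∀ n, a n = ((LinearMap.mulLeft ℚ Z - LinearMap.mulRight ℚ Z) ^ n) (D Z) := by
    intro n
    induction n with
    | zero => simp [ha0]
    | succ n ih =>
      rw [ha, pow_succ', Module.End.mul_apply, ← ih]
      simp
  have ha_zero : ∀ n, K₂ ≤ n → a n = 0 := by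
    intro n hn
    rw [haeq, pow_eq_zero_of_le hn hK₂]; simp
  have hZ_zero : ∀ n, K ≤ n → Z ^ n = 0 := fun n hn => pow_eq_zero_of_le hn hK
  refine ⟨K + K₂, ?_⟩
  set B := K + K₂ + 1 with hB
  have e1 : exp Z = ∑ i ∈ range (B + 1), (i.factorial : ℚ)⁻¹ • Z ^ i :=
    exp_eq_sum (hZ_zero _ (by omega))
  have e2 : exp Z = ∑ i ∈ range B, (i.factorial : ℚ)⁻¹ • Z ^ i :=
    exp_eq_sum (hZ_zero _ (by omega))
  have hD1 : D 1 = 0 := by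
    have := hD 1 1
    simpa using this
  conv_lhs => rw [e1]
  rw [e2, Finset.sum_range_succ', map_add, map_sum, Finset.sum_mul_sum, ← sum_diag]
  · simp only [pow_zero, map_smul, hD1, smul_zero, add_zero]
    refine Finset.sum_congr rfl fun n _ => ?_
    rw [deriv_pow D hD Z a ha0 ha, Finset.smul_sum]
    refine Finset.sum_congr rfl fun p hp => ?_
    rw [smul_smul, smul_mul_smul_comm]
    congr 1
    rw [Finset.HasAntidiagonal.mem_antidiagonal] at hp
    rw [← hp, Nat.cast_choose ℚ (by omega), show p.1 + p.2 + 1 - (p.1 + 1) = p.2 by omega]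
    have h1 : ((p.1 + p.2 + 1).factorial : ℚ) ≠ 0 := by exact_mod_cast Nat.factorial_ne_zero _
    have h2 : ((p.1 + 1).factorial : ℚ) ≠ 0 := by exact_mod_cast Nat.factorial_ne_zero _
    have h3 : ((p.2).factorial : ℚ) ≠ 0 := by exact_mod_cast Nat.factorial_ne_zero _
    field_simp
  · intro i j hij
    by_cases hi : K₂ ≤ i
    · simp [ha_zero i hi]
    · simp [hZ_zero j (by omega)]

open Polynomial in
theorem log_approx (U : S) (hU : IsNilpotent U) (n : ℕ) :
    ∃ p r : ℚ[X], exp (aeval U (X * p)) = aeval U (1 + X + X ^ (n + 1) * r) := by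
  have nil : ∀ q : ℚ[X], IsNilpotent (aeval U (X * q)) := by
    intro q
    rw [map_mul, aeval_X]
    refine Commute.isNilpotent_mul_right ?_ hU
    have h2 := congrArg (aeval U) (mul_comm X q)
    simpa [Commute, SemiconjBy] using h2
  induction n with
  | zero => exact ⟨0, -1, by simp [exp_zero]⟩
  | succ n ih =>
    obtain ⟨p, r, h⟩ := ih
    set c : ℚ := - r.coeff 0 with hc
    obtain ⟨r1, hr1⟩ : ∃ r1, r = X * r1 + C (r.coeff 0) := ⟨r.divX, (X_mul_divX_add r).symm⟩
    obtain ⟨s, hs⟩ : ∃ s : ℚ[X], exp (aeval U (X * (C c * X ^ n)))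
        = aeval U (1 + C c * X ^ (n + 1) + X ^ (n + 2) * s) := by
      obtain ⟨w, hw⟩ : ∃ w : ℚ[X], C c = w := ⟨_, rfl⟩
      rw [hw]
      obtain ⟨K, hK⟩ := nil (w * X ^ n)
      rw [exp_eq_sum (pow_eq_zero_of_le (show K ≤ K + 2 by omega) hK)]
      refine ⟨∑ i ∈ range K, (((i + 1 + 1).factorial : ℚ)⁻¹ • (w ^ (i + 2) * X ^ (n * (i + 1) + i))), ?_⟩
      rw [Finset.sum_range_succ', Finset.sum_range_succ']
      simp only [← map_pow, ← map_smul, ← map_sum, ← map_add]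
      congr 1
      simp only [zero_add, Nat.factorial_one, Nat.factorial_zero, Nat.cast_one, inv_one, one_smul,
        pow_one, pow_zero, Finset.mul_sum]
      have : ∀ i ∈ range K, ((i + 1 + 1).factorial : ℚ)⁻¹ • (X * (w * X ^ n)) ^ (i + 1 + 1)
        = X ^ (n + 2) * (((i + 1 + 1).factorial : ℚ)⁻¹ • (w ^ (i + 2) * X ^ (n * (i + 1) + i))) := by
        intro i _
        rw [mul_smul_comm]
        congr 1
        ring
      rw [Finset.sum_congr rfl this]
      ring
    refine ⟨p + C c * X ^ n, r1 + C c + s + X * s + X ^ n * r * (C c + X * s), ?_⟩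
    rw [mul_add, map_add, exp_add_of_commute _ (nil _) (nil _), h, hs, ← map_mul]
    · congr 1
      have hcr : C c = -C (r.coeff 0) := by simp [hc]
      generalize C (r.coeff 0) = c0 at *
      rw [hr1, hcr]
      ring
    · have h2 := congrArg (aeval U) (mul_comm (X * p) (X * (C c * X ^ n)))
      rw [map_mul, map_mul _ (X * (C c * X ^ n))] at h2
      exact h2

open Polynomial in
theorem exists_log (U : S) (hU : IsNilpotent U) :
    ∃ p : ℚ[X], exp (aeval U (X * p)) = 1 + U := by
  obtain ⟨K, hK⟩ := hU
  obtain ⟨p, r, h⟩ := log_approx U ⟨K, hK⟩ K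
  refine ⟨p, h.trans ?_⟩
  simp [pow_succ', hK]

end deriv
section main
variable {R : Type*} [Ring R] [Algebra ℚ R]
open Polynomial

/-- Polynomials whose `n`-th coefficient lies in `M ^ n`. -/
def rees (M : Submodule ℚ R) : Subalgebra ℚ R[X] where
  carrier := {p | ∀ n, p.coeff n ∈ M ^ n}
  mul_mem' := by
    intro p q hp hq n
    rw [coeff_mul]
    refine Submodule.sum_mem _ fun x hx => ?_
    rw [← Finset.HasAntidiagonal.mem_antidiagonal.1 hx, pow_add]
    exact Submodule.mul_mem_mul (hp _) (hq _)
  add_mem' := by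
    intro p q hp hq n
    rw [coeff_add]
    exact Submodule.add_mem _ (hp n) (hq n)
  algebraMap_mem' := by
    intro r n
    rw [Polynomial.algebraMap_apply, coeff_C]
    split_ifs with h
    · subst h
      rw [pow_zero]
      exact Submodule.algebraMap_mem r
    · exact Submodule.zero_mem _

theorem mem_rees {M : Submodule ℚ R} {p : R[X]} : p ∈ rees M ↔ ∀ n, p.coeff n ∈ M ^ n := Iff.rfl

theorem rees_nilp {M : Submodule ℚ R} {N : ℕ} (hM : M ^ N = ⊥) {p : R[X]} (hp : p ∈ rees M)
    (h0 : p.coeff 0 = 0) : p ^ N = 0 := by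
  obtain ⟨q, rfl⟩ := X_dvd_iff.2 h0
  have hpN := mem_rees.1 (pow_mem hp N)
  ext n
  rw [coeff_zero]
  by_cases hn : N ≤ n
  · have := hpN n
    rw [← Nat.add_sub_cancel' hn, pow_add, hM, Submodule.bot_mul, Submodule.mem_bot] at this
    rwa [Nat.add_sub_cancel' hn] at this
  · rw [(commute_X q).mul_pow, coeff_X_pow_mul', if_neg hn]

theorem exp_mem (G : Subalgebra ℚ R[X]) {p : R[X]} (hp : p ∈ G) : exp p ∈ G := by
  rw [IsNilpotent.exp]
  exact Subalgebra.sum_mem _ fun i _ => Subalgebra.smul_mem _ (pow_mem hp i) _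

theorem coeff_bracket_mem {M : Submodule ℚ R} (hbr : ∀ x ∈ M, ∀ y ∈ M, x * y - y * x ∈ M)
    {Z W : R[X]} {n : ℕ} (h0 : Z.coeff 0 = 0) (hZ : ∀ i ≤ n, Z.coeff i ∈ M)
    (hW : ∀ i < n, W.coeff i ∈ M) : ∀ i ≤ n, (Z * W - W * Z).coeff i ∈ M := by
  intro i hi
  have : (Z * W - W * Z).coeff i = ∑ x ∈ antidiagonal i,
      (Z.coeff x.1 * W.coeff x.2 - W.coeff x.2 * Z.coeff x.1) := by
    rw [coeff_sub, coeff_mul, coeff_mul, Finset.sum_sub_distrib]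
    congr 1
    exact (Finset.Nat.sum_antidiagonal_swap (f := fun x : ℕ × ℕ => W.coeff x.1 * Z.coeff x.2)).symm
  rw [this]
  refine Submodule.sum_mem _ fun x hx => ?_
  rw [Finset.HasAntidiagonal.mem_antidiagonal] at hx
  rcases Nat.eq_zero_or_pos x.1 with h | h
  · simp [h, h0]
  · exact hbr _ (hZ _ (by omega)) _ (hW _ (by omega))

theorem deriv_exp_lin (x : R) (hx : IsNilpotent (C x * X : R[X])) :
    derivative (exp (C x * X : R[X])) = C x * exp (C x * X) := by
  let D : R[X] →ₗ[ℚ] R[X] := (derivative (R := R)).restrictScalars ℚ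
  obtain ⟨B, hB⟩ := deriv_exp D (fun a b => derivative_mul) (C x * X) hx
    (fun n => if n = 0 then C x else 0) (by simp [D]) (by
      intro n
      by_cases h : n = 0
      · subst h
        simp only [if_true]
        rw [mul_assoc, X_mul_C]; simp
      · simp [h])
  change D _ = _
  rw [hB, Finset.sum_eq_single 0]
  · simp
  · intro b _ hb; simp [hb]
  · simp

theorem bch (M : Submodule ℚ R) (hbr : ∀ x ∈ M, ∀ y ∈ M, x * y - y * x ∈ M)
    {N : ℕ} (hM : M ^ N = ⊥) {x y : R} (hx : x ∈ M) (hy : y ∈ M) :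
    ∃ z ∈ M, exp z = exp x * exp y := by
  have lin : ∀ x ∈ M, (C x * X : R[X]) ∈ rees M := by
    intro x hx n
    rw [coeff_C_mul, coeff_X]
    split_ifs with h
    · subst h; simpa using hx
    · simp
  have lin0 : ∀ x : R, (C x * X : R[X]).coeff 0 = 0 := by intro x; simp
  have nilx : IsNilpotent (C x * X : R[X]) := ⟨N, rees_nilp hM (lin x hx) (lin0 x)⟩
  have nily : IsNilpotent (C y * X : R[X]) := ⟨N, rees_nilp hM (lin y hy) (lin0 y)⟩
  set Ex := exp (C x * X : R[X]) with hEx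
  set Ey := exp (C y * X : R[X]) with hEy
  -- evaluation homs
  let ev0 : R[X] →+* R := eval₂RingHom' (RingHom.id R) 0 (fun a => Commute.zero_right _)
  let ev1 : R[X] →+* R := eval₂RingHom' (RingHom.id R) 1 (fun a => Commute.one_right _)
  have hev0 : ∀ p, ev0 p = p.coeff 0 := by
    intro p
    change eval₂ (RingHom.id R) 0 p = _
    rw [eval₂_at_zero]; rfl
  have hev1 : ∀ p, ev1 p = p.sum fun _ a => a := by
    intro p
    change eval₂ (RingHom.id R) 1 p = _
    rw [eval₂_eq_sum]; simp
  have hlin1 : ∀ x : R, ev1 (C x * X) = x := by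
    intro x
    change eval₂ (RingHom.id R) 1 (C x * X) = _
    rw [eval₂_mul_X, eval₂_C]; simp
  have mem : Ex * Ey ∈ rees M :=
    mul_mem (exp_mem _ (lin x hx)) (exp_mem _ (lin y hy))
  have c0 : (Ex * Ey).coeff 0 = 1 := by
    rw [← hev0, map_mul, hEx, hEy, map_exp nilx, map_exp nily, hev0, hev0, lin0, lin0, exp_zero,
      one_mul]
  obtain ⟨p, hp⟩ := exists_log (Ex * Ey - 1)
    ⟨N, rees_nilp hM (sub_mem mem (one_mem _)) (by simp [c0])⟩
  set Z : R[X] := aeval (Ex * Ey - 1) (X * p) with hZdef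
  have hZE : exp Z = Ex * Ey := by rw [hp]; abel
  have hZmem : Z ∈ rees M := by
    have : Z ∈ Algebra.adjoin ℚ {Ex * Ey - 1} := aeval_mem_adjoin_singleton ℚ _
    refine Algebra.adjoin_le ?_ this
    rintro _ rfl
    exact sub_mem mem (one_mem _)
  have hZ0 : Z.coeff 0 = 0 := by
    rw [← hev0, hZdef, map_mul, aeval_X, map_mul, hev0]
    simp [c0]
  have hZnil : IsNilpotent Z := ⟨N, rees_nilp hM hZmem hZ0⟩
  let D : R[X] →ₗ[ℚ] R[X] := (derivative (R := R)).restrictScalars ℚ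
    + (LinearMap.mulLeft ℚ (C y) - LinearMap.mulRight ℚ (C y))
  have hDapp : ∀ q, D q = derivative q + (C y * q - q * C y) := fun q => rfl
  let a : ℕ → R[X] := fun n => (fun w => Z * w - w * Z)^[n] (D Z)
  have ha : ∀ n, a (n + 1) = Z * a n - a n * Z := fun n => Function.iterate_succ_apply' _ _ _
  obtain ⟨B, hB⟩ := deriv_exp D (by
    intro u v
    rw [hDapp, hDapp, hDapp, derivative_mul]
    noncomm_ring) Z hZnil a rfl ha
  have hDE : D (exp Z) = C (x + y) * exp Z := by
    have comm : Ey * C y = C y * Ey := by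
      have h1 : Commute (C y) (C y * X : R[X]) := by
        unfold Commute SemiconjBy
        rw [mul_assoc, X_mul_C]
      rw [hEy, IsNilpotent.exp, Finset.sum_mul, Finset.mul_sum]
      refine Finset.sum_congr rfl fun i _ => ?_
      rw [smul_mul_assoc, mul_smul_comm, (h1.pow_right i).eq]
    rw [hDapp, hZE, derivative_mul, deriv_exp_lin x nilx, deriv_exp_lin y nily, ← hEx, ← hEy,
      mul_assoc Ex Ey, comm, C_add]
    noncomm_ring
  have key : ∑ k ∈ range (B + 1), ((k + 1).factorial : ℚ)⁻¹ • a k = C (x + y) := by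
    have := hB.symm.trans hDE
    exact (isUnit_exp hZnil).mul_right_cancel this
  have hcoef : ∀ n, ∀ i ≤ n, Z.coeff i ∈ M := by
    intro n
    induction n with
    | zero =>
      intro i hi
      obtain rfl : i = 0 := by omega
      rw [hZ0]; exact M.zero_mem
    | succ n ih =>
      intro i hi
      rcases Nat.lt_or_ge i (n + 1) with h | h
      · exact ih i (by omega)
      obtain rfl : i = n + 1 := by omega
      have hDZ : ∀ j, (D Z).coeff j
          = ((j + 1 : ℕ) : ℚ) • Z.coeff (j + 1) + (y * Z.coeff j - Z.coeff j * y) := by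
        intro j
        rw [hDapp, coeff_add, coeff_sub, coeff_C_mul, coeff_mul_C, coeff_derivative]
        congr 1
        rw [Nat.cast_smul_eq_nsmul ℚ, nsmul_eq_mul, ← Nat.cast_succ, Nat.cast_comm]
      have hlow : ∀ j < n, (D Z).coeff j ∈ M := by
        intro j hj
        rw [hDZ]
        exact M.add_mem (M.smul_mem _ (ih _ (by omega))) (hbr _ hy _ (ih _ (by omega)))
      have hak : ∀ k, ∀ j ≤ n, (a (k + 1)).coeff j ∈ M := by
        intro k
        induction k with
        | zero =>
          rw [ha]
          exact coeff_bracket_mem hbr hZ0 ih hlow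
        | succ k ihk =>
          rw [ha]
          exact coeff_bracket_mem hbr hZ0 ih (fun j hj => ihk j hj.le)
      have hk := congrArg (fun q => q.coeff n) key
      beta_reduce at hk
      rw [Finset.sum_range_succ', coeff_add, finsetSum_coeff] at hk
      have h1 : ∑ k ∈ range B, (((k + 1 + 1).factorial : ℚ)⁻¹ • a (k + 1)).coeff n ∈ M := by
        refine Submodule.sum_mem _ fun k _ => ?_
        rw [coeff_smul]
        exact M.smul_mem _ (hak k n le_rfl)
      have h2 : (C (x + y)).coeff n ∈ M := by
        rw [coeff_C]
        split_ifs
        · exact M.add_mem hx hy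
        · exact M.zero_mem
      rw [← hk] at h2
      have h3 := (Submodule.add_mem_iff_right M h1).1 h2
      have ha0 : a 0 = D Z := rfl
      rw [ha0] at h3
      simp only [zero_add, Nat.factorial_one, Nat.cast_one, inv_one, one_smul] at h3
      rw [hDZ] at h3
      have h4 := (Submodule.add_mem_iff_left M (hbr _ hy _ (ih n le_rfl))).1 h3
      exact (Submodule.smul_mem_iff M (by positivity)).1 h4
  refine ⟨ev1 Z, ?_, ?_⟩
  · rw [hev1]
    exact Submodule.sum_mem _ fun i _ => hcoef i i le_rfl
  · rw [← map_exp hZnil, hZE, map_mul, hEx, hEy, map_exp nilx, map_exp nily, hlin1, hlin1]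

end main

end BCHaux

namespace DGLA
variable {k : Type*} {A : Type*} [Field k] [CharZero k] [AddCommGroup A] [Module k A]
  [DGLA k A]

theorem antisymm0 {x : A} (hx : x ∈ gr k 0) (c : A) : ad k c x = - ad k x c := by
  have htop : c ∈ ⨆ n, (gr k n : Submodule k A) := by
    have : ⨆ n, (gr k n : Submodule k A) = ⊤ := (DGLA.isInternal (k := k) (A := A)).submodule_iSup_eq_top
    rw [this]; trivial
  induction htop using Submodule.iSup_induction' with
  | mem n c hc =>
    have := DGLA.bracket_antisymm (k := k) 0 n x c hx hc
    rw [zero_mul, zpow_zero, one_smul] at this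
    exact this
  | zero => simp [ad]
  | add a b _ _ ha hb =>
    have : ad k (a + b) x = ad k a x + ad k b x := by simp [ad]
    rw [this, ha, hb, map_add, neg_add]

theorem ad_br {x y : A} (hx : x ∈ gr k 0) (hy : y ∈ gr k 0) (c : A) :
    ad k (br k x y) c = ad k x (ad k y c) - ad k y (ad k x c) := by
  have htop : c ∈ ⨆ n, (gr k n : Submodule k A) := by
    have : ⨆ n, (gr k n : Submodule k A) = ⊤ := (DGLA.isInternal (k := k) (A := A)).submodule_iSup_eq_top
    rw [this]; trivial
  induction htop using Submodule.iSup_induction' with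
  | mem n c hc =>
    have := DGLA.jacobi (k := k) 0 0 n x y c hx hy hc
    rw [zero_mul, mul_zero, zero_mul, zpow_zero, one_smul, one_smul, one_smul] at this
    change ad k (ad k y c) x + ad k (ad k c x) y + ad k (br k x y) c = 0 at this
    rw [antisymm0 hx, antisymm0 hy, antisymm0 hx, map_neg] at this
    rw [← sub_eq_zero, ← this]
    abel
  | zero => simp
  | add a b _ _ ha hb =>
    simp only [map_add, ha, hb]
    abel

variable (k A) in
/-- The representation on `A × k` linearising the flow. -/
noncomputable def rho : A →ₗ[k] Module.End k (A × k) where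
  toFun e := LinearMap.inl k A k ∘ₗ
    (ad k e ∘ₗ LinearMap.fst k A k - (LinearMap.snd k A k).smulRight (D k e))
  map_add' x y := by
    ext <;> simp [ad]
    abel
  map_smul' c x := by
    ext <;> simp [ad]

theorem rho_apply (e a : A) (t : k) : rho k A e (a, t) = (ad k e a - t • D k e, 0) := rfl

theorem rho_br {x y : A} (hx : x ∈ gr k 0) (hy : y ∈ gr k 0) :
    rho k A x * rho k A y - rho k A y * rho k A x = rho k A (br k x y) := by
  refine LinearMap.ext fun p => ?_
  obtain ⟨a, t⟩ := p
  rw [LinearMap.sub_apply, Module.End.mul_apply, Module.End.mul_apply]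
  simp only [rho_apply, zero_smul, sub_zero, Prod.mk_sub_mk, map_sub, map_smul]
  have h1 : D k (br k x y) = - ad k y (D k x) + ad k x (D k y) := by
    have := DGLA.leibniz (k := k) 0 x y hx
    rw [zpow_zero, one_smul] at this
    change D k (br k x y) = ad k (D k x) y + ad k x (D k y) at this
    rw [this, antisymm0 hy]
  rw [ad_br hx hy, h1]
  congr 1
  module

theorem rho_pow_succ (z a : A) (t : k) (n : ℕ) :
    (rho k A z ^ (n + 1)) (a, t) = ((ad k z ^ (n + 1)) a - t • (ad k z ^ n) (D k z), 0) := by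
  induction n with
  | zero => simp [rho_apply]
  | succ n ih =>
    rw [pow_succ', Module.End.mul_apply, ih, rho_apply, pow_succ' _ (n + 1), pow_succ' _ n]
    simp [Module.End.mul_apply]

theorem prod_rho {n : ℕ} (g : Fin n → A) (a : A) :
    (List.ofFn fun i => rho k A (g i)).prod (a, 0) = ((List.ofFn fun i => ad k (g i)).prod a, 0) := by
  induction n with
  | zero => simp
  | succ n ih =>
    rw [List.ofFn_succ, List.ofFn_succ, List.prod_cons, List.prod_cons, Module.End.mul_apply, ih,
      rho_apply]
    simp

theorem prod_rho_zero {N : ℕ} (g : Fin (N + 1) → A)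
    (h : (List.ofFn fun i : Fin N => ad k (g i.castSucc)).prod = 0) :
    (List.ofFn fun i => rho k A (g i)).prod = 0 := by
  refine LinearMap.ext fun p => ?_
  obtain ⟨a, t⟩ := p
  rw [List.ofFn_succ', List.concat_eq_append, List.prod_append, Module.End.mul_apply]
  simp only [List.prod_cons, List.prod_nil, mul_one]
  rw [rho_apply, prod_rho (fun i : Fin N => g i.castSucc), h]
  simp

theorem exp_rho [Module ℚ (Module.End k (A × k))] (z : A) (N : ℕ) (h : ad k z ^ N = 0)
    (a : A) (t : k) :
    IsNilpotent.exp (-rho k A z) (a, t)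
      = (expNeg k (ad k z) N a + t • Fser k (ad k z) N (D k z), t) := by
  have hn : (-rho k A z) ^ (N + 1) = 0 := by
    rw [← neg_one_smul k (rho k A z), smul_pow]
    convert smul_zero _
    refine LinearMap.ext fun p => ?_
    obtain ⟨a, t⟩ := p
    rw [rho_pow_succ, pow_succ, h]
    simp
  rw [IsNilpotent.exp_eq_sum hn]
  have hsm : ∀ (q : ℚ) (f : Module.End k (A × k)), q • f = (q : k) • f := by
    intro q f
    exact (Rat.cast_smul_eq_qsmul k q f).symm
  have hterm : ∀ n, (((n + 1).factorial : ℚ)⁻¹ • (-rho k A z) ^ (n + 1)) (a, t)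
      = (((-1 : k) ^ (n + 1) * ((n + 1).factorial : k)⁻¹) • (ad k z ^ (n + 1)) a
        + t • ((-1 : k) ^ n * ((n + 1).factorial : k)⁻¹) • (ad k z ^ n) (D k z), 0) := by
    intro n
    rw [hsm, ← neg_one_smul k (rho k A z), smul_pow, LinearMap.smul_apply, LinearMap.smul_apply,
      rho_pow_succ]
    push_cast
    ext
    · simp only [Prod.smul_mk]
      rw [pow_succ (-1 : k)]
      module
    · simp
  rw [LinearMap.sum_apply, Finset.sum_range_succ', Finset.sum_congr rfl fun n _ => hterm n]
  have h2 : expNeg k (ad k z) N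
      = ∑ n ∈ Finset.range (N + 1), ((-1 : k) ^ n * (Nat.factorial n : k)⁻¹) • ad k z ^ n := by
    rw [Finset.sum_range_succ, h, smul_zero, add_zero]; rfl
  rw [h2, Finset.sum_range_succ', Fser]
  ext
  · simp [Prod.fst_sum, Finset.sum_add_distrib, Finset.smul_sum]
    abel
  · simp [Prod.snd_sum]

end DGLA

open DGLA in
/-- composition of flows (Lemma 2.7). In a DGLA over a field `k` of
characteristic zero, let `e₁, e₂ ∈ A₀` and let `L` be a Lie subalgebra of `A₀` generated by
(in particular, containing) `e₁` and `e₂`, acting nilpotently on `A` in the sense that every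
composition of `N` operators `ad_x` with `x ∈ L` vanishes. Then there exists `z ∈ L`
(the Baker–Campbell–Hausdorff composition `BCH(e₁, e₂)`) with
`exp(−ad_z) = exp(−ad_{e₂}) ∘ exp(−ad_{e₁})` as operators on `A`, and
`u_{e₂}(u_{e₁}(a)) = u_z(a)` for every `a ∈ A₋₁`. -/
theorem flow_comp_eq_flow_BCH {k A : Type*} [Field k] [CharZero k]
    [AddCommGroup A] [Module k A] [DGLA k A]
    (e₁ e₂ : A) (he₁ : e₁ ∈ gr k 0) (he₂ : e₂ ∈ gr k 0)
    (L : Submodule k A) (hL : L ≤ gr k 0)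
    (hLbr : ∀ x ∈ L, ∀ y ∈ L, br k x y ∈ L)
    (he₁L : e₁ ∈ L) (he₂L : e₂ ∈ L) (N : ℕ)
    (hnil : ∀ g : Fin N → A, (∀ i, g i ∈ L) →
      (List.ofFn fun i => ad k (g i)).prod = 0) :
    ∃ z ∈ L,
      expNeg k (ad k z) N = expNeg k (ad k e₂) N ∘ₗ expNeg k (ad k e₁) N ∧
      ∀ a ∈ gr k (-1), flow k e₂ N (flow k e₁ N a) = flow k z N a := by
  letI : Algebra ℚ (Module.End k (A × k)) := Algebra.compHom _ (algebraMap ℚ k)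
  have hsm : ∀ (q : ℚ) (f : Module.End k (A × k)), q • f = (q : k) • f := by
    intro q f
    exact (Rat.cast_smul_eq_qsmul k q f).symm
  let M : Submodule ℚ (Module.End k (A × k)) :=
    { carrier := {f | ∃ x ∈ L, rho k A x = f}
      add_mem' := by
        rintro _ _ ⟨x, hx, rfl⟩ ⟨y, hy, rfl⟩
        exact ⟨x + y, L.add_mem hx hy, map_add _ _ _⟩
      zero_mem' := ⟨0, L.zero_mem, map_zero _⟩
      smul_mem' := by
        rintro q _ ⟨x, hx, rfl⟩
        exact ⟨(q : k) • x, L.smul_mem _ hx, by rw [map_smul, hsm]⟩ }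
  have hbr : ∀ f ∈ M, ∀ g ∈ M, f * g - g * f ∈ M := by
    rintro _ ⟨x, hx, rfl⟩ _ ⟨y, hy, rfl⟩
    exact ⟨br k x y, hLbr x hx y hy, (rho_br (hL hx) (hL hy)).symm⟩
  have hM : M ^ (N + 1) = ⊥ := by
    rw [Submodule.pow_eq_span_pow_set, Submodule.span_eq_bot]
    intro f hf
    obtain ⟨g, rfl⟩ := Set.mem_pow.1 hf
    choose x hx hxg using fun i => (g i).2
    have : (fun i => ((g i : Module.End k (A × k)))) = fun i => rho k A (x i) := by
      funext i; exact (hxg i).symm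
    rw [this]
    exact prod_rho_zero x (hnil _ fun i => hx _)
  obtain ⟨f, ⟨w, hw, rfl⟩, hexp⟩ := BCHaux.bch M hbr hM
    (M.neg_mem ⟨e₂, he₂L, rfl⟩) (M.neg_mem ⟨e₁, he₁L, rfl⟩)
  have hadN : ∀ x ∈ L, ad k x ^ N = 0 := by
    intro x hx
    have := hnil (fun _ => x) fun _ => hx
    simpa using this
  have hw' : rho k A w = - rho k A (-w) := by simp
  rw [hw'] at hexp
  have hz : -w ∈ L := L.neg_mem hw
  have main : ∀ a t, _ := fun (a : A) (t : k) => LinearMap.congr_fun hexp (a, t)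
  simp only [Module.End.mul_apply, exp_rho _ N (hadN _ hz), exp_rho _ N (hadN _ he₁L),
    exp_rho _ N (hadN _ he₂L)] at main
  refine ⟨-w, hz, ?_, ?_⟩
  · refine LinearMap.ext fun a => ?_
    have := congrArg Prod.fst (main a 0)
    simpa using this
  · intro a _
    have := congrArg Prod.fst (main a 1)
    simpa [flow] using this.symm
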